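/- arXiv:2411.12206 — 2 statements merged into one kernel-verified Lean document; each statement's English description precedes it below -/
import Mathlib

section
/- Suppose in addition that the point x satisfies c_x ≤ ‖x‖ ≤ c̄_x for positive constants c_x ≤ c̄_x. Then the divergence of the closed-loop density flux admits the lower bound div_x( k ρ_o )(t,x) ≥ (α β n / V₁(x)^{2α}) [ (2α+1) ( d̄_V c̄_x² + κ )^{-2} ( d_{Vx} c_x θ )² − 4 d_V^{-1} d̄_{Vx} c̄_{Ψx} c_x^{-1} − κ^{-1} d̄_{Vx²} − α^{-1} c̄_{Ψx²} ]. -/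
open Set

/-- Divergence of a vector field on `ℝⁿ` (Euclidean space). -/
noncomputable def divergence {n : ℕ}
    (F : EuclideanSpace ℝ (Fin n) → EuclideanSpace ℝ (Fin n))
    (x : EuclideanSpace ℝ (Fin n)) : ℝ :=
  ∑ j : Fin n, fderiv ℝ F x (EuclideanSpace.single j 1) j

/-- First partial derivative `∂g/∂x_j`. -/
noncomputable def pd {n : ℕ} (j : Fin n)
    (g : EuclideanSpace ℝ (Fin n) → ℝ) (x : EuclideanSpace ℝ (Fin n)) : ℝ :=
  fderiv ℝ g x (EuclideanSpace.single j 1)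

/-- Second partial derivative `∂²g/∂x_j²`. -/
noncomputable def pd2 {n : ℕ} (j : Fin n)
    (g : EuclideanSpace ℝ (Fin n) → ℝ) (x : EuclideanSpace ℝ (Fin n)) : ℝ :=
  fderiv ℝ (fun y => fderiv ℝ g y (EuclideanSpace.single j 1)) x (EuclideanSpace.single j 1)

lemma aux_rpow {n : ℕ} (j : Fin n) (W : EuclideanSpace ℝ (Fin n) → ℝ) (p : ℝ)
    (x : EuclideanSpace ℝ (Fin n)) (hW : DifferentiableAt ℝ W x) (h0 : 0 < W x) :
    pd j (fun y => W y ^ p) x = p * W x ^ (p - 1) * pd j W x := by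
  have := (hW.hasFDerivAt.rpow_const (p := p) (Or.inl h0.ne')).fderiv
  simp [pd, this]

lemma aux_mul {n : ℕ} (j : Fin n) (f g : EuclideanSpace ℝ (Fin n) → ℝ)
    (x : EuclideanSpace ℝ (Fin n)) (hf : DifferentiableAt ℝ f x) (hg : DifferentiableAt ℝ g x) :
    pd j (fun y => f y * g y) x = pd j f x * g x + f x * pd j g x := by
  have := (hf.hasFDerivAt.mul hg.hasFDerivAt).fderiv
  simp only [pd]
  erw [this]
  simp; ring

lemma aux_div {n : ℕ} (ρ : EuclideanSpace ℝ (Fin n) → ℝ) (h : ContDiff ℝ 2 ρ) (β : ℝ)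
    (x : EuclideanSpace ℝ (Fin n)) :
    divergence (fun y => ρ y • β • gradient ρ y) x
      = ∑ j, β * (pd j ρ x ^ 2 + ρ x * pd2 j ρ x) := by
  have h1 : Differentiable ℝ (fderiv ℝ ρ) :=
    (h.fderiv_right (m := 1) (by norm_num)).differentiable (by norm_num)
  have hd : Differentiable ℝ ρ := h.differentiable (by norm_num)
  have hg : Differentiable ℝ (gradient ρ) := by
    unfold gradient
    exact (InnerProductSpace.toDual ℝ (EuclideanSpace ℝ (Fin n))).symm.toContinuousLinearEquiv.differentiable.comp h1
  have hF : Differentiable ℝ (fun y => ρ y • β • gradient ρ y) := hd.smul (hg.const_smul β)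
  unfold divergence
  refine Finset.sum_congr rfl fun j _ => ?_
  have e1 : fderiv ℝ (fun y => ρ y • β • gradient ρ y) x (EuclideanSpace.single j 1) j
      = pd j (fun y => (ρ y • β • gradient ρ y) j) x := by
    have := ((EuclideanSpace.proj j : EuclideanSpace ℝ (Fin n) →L[ℝ] ℝ).hasFDerivAt.comp x (hF x).hasFDerivAt).fderiv
    unfold pd
    have e : (fun y => (ρ y • β • gradient ρ y) j) = (EuclideanSpace.proj j : EuclideanSpace ℝ (Fin n) →L[ℝ] ℝ) ∘ (fun y => ρ y • β • gradient ρ y) := by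
      ext y; simp
    rw [e, this]; simp
  have e2 : (fun y => (ρ y • β • gradient ρ y) j) = fun y => (β * ρ y) * pd j ρ y := by
    ext y
    have : (gradient ρ y) j = pd j ρ y := by
      have := InnerProductSpace.toDual_symm_apply (𝕜 := ℝ) (x := EuclideanSpace.single j (1:ℝ)) (y := fderiv ℝ ρ y)
      unfold pd
      rw [← this, EuclideanSpace.inner_single_right]
      simp [gradient]
    simp [this]; ring
  have hp : Differentiable ℝ (pd j ρ) := h1.clm_apply (differentiable_const _)
  rw [e1, e2, aux_mul j (fun y => β * ρ y) (pd j ρ) x ((hd x).const_mul β) (hp x),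
    aux_mul j (fun _ => β) ρ x (differentiableAt_const _) (hd x)]
  have : pd2 j ρ x = pd j (pd j ρ) x := rfl
  have h0 : pd j (fun _ : EuclideanSpace ℝ (Fin n) => β) x = 0 := by simp [pd]
  rw [this, h0]; ring

lemma aux_term {n : ℕ} (j : Fin n) (α κ : ℝ) (hκ : 0 < κ) (P V : EuclideanSpace ℝ (Fin n) → ℝ)
    (hP : ContDiff ℝ 2 P) (hV : ContDiff ℝ 2 V) (hVnn : ∀ y, 0 ≤ V y)
    (x : EuclideanSpace ℝ (Fin n)) :
    pd j (fun y => P y / (V y + κ) ^ α) x ^ 2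
      + P x / (V x + κ) ^ α * pd2 j (fun y => P y / (V y + κ) ^ α) x
    = ((V x + κ) ^ (2 * α))⁻¹ * (pd j P x ^ 2
        + α * (2 * α + 1) * (P x * pd j V x / (V x + κ)) ^ 2
        - 4 * α * P x * pd j P x * (pd j V x / (V x + κ))
        - α * P x ^ 2 * (pd2 j V x / (V x + κ)) + P x * pd2 j P x) := by
  have hpos : ∀ y, 0 < V y + κ := fun y => by linarith [hVnn y]
  have dP : Differentiable ℝ P := hP.differentiable (by norm_num)
  have dV : Differentiable ℝ V := hV.differentiable (by norm_num)
  have dW : Differentiable ℝ (fun y => V y + κ) := dV.add_const κ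
  have dPj : Differentiable ℝ (pd j P) :=
    ((hP.fderiv_right (m := 1) (by norm_num)).differentiable (by norm_num)).clm_apply
      (differentiable_const _)
  have dVj : Differentiable ℝ (pd j V) :=
    ((hV.fderiv_right (m := 1) (by norm_num)).differentiable (by norm_num)).clm_apply
      (differentiable_const _)
  have dpow : ∀ p : ℝ, Differentiable ℝ (fun y => (V y + κ) ^ p) := fun p y =>
    (dW y).rpow_const (Or.inl (hpos y).ne')
  have hWj : ∀ y, pd j (fun y => V y + κ) y = pd j V y := fun y => by simp [pd]
  have hpw : ∀ (p : ℝ) y, pd j (fun y => (V y + κ) ^ p) y = p * (V y + κ) ^ (p - 1) * pd j V y :=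
    fun p y => by rw [aux_rpow j _ p y (dW y) (hpos y), hWj]
  have e0 : (fun y => P y / (V y + κ) ^ α) = fun y => P y * (V y + κ) ^ (-α) := by
    ext y; rw [Real.rpow_neg (hpos y).le, div_eq_mul_inv]
  have e1 : pd j (fun y => P y * (V y + κ) ^ (-α)) = fun y => pd j P y * (V y + κ) ^ (-α)
      + P y * (-α * (V y + κ) ^ (-α - 1) * pd j V y) := by
    ext y
    rw [aux_mul j P _ y (dP y) (dpow _ y), hpw]
  have hadd : ∀ f g : EuclideanSpace ℝ (Fin n) → ℝ, Differentiable ℝ f → Differentiable ℝ g →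
      pd j (fun y => f y + g y) x = pd j f x + pd j g x := fun f g hf hg => by
    unfold pd; rw [fderiv_fun_add (hf x) (hg x)]; rfl
  have e2 : pd2 j (fun y => P y * (V y + κ) ^ (-α)) x
      = pd2 j P x * (V x + κ) ^ (-α) + pd j P x * (-α * (V x + κ) ^ (-α - 1) * pd j V x)
        + (pd j P x * (-α * (V x + κ) ^ (-α - 1) * pd j V x)
          + P x * (-α * ((-α - 1) * (V x + κ) ^ (-α - 1 - 1) * pd j V x) * pd j V x
            + -α * (V x + κ) ^ (-α - 1) * pd2 j V x)) := by
    have : pd2 j (fun y => P y * (V y + κ) ^ (-α)) x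
      = pd j (pd j (fun y => P y * (V y + κ) ^ (-α))) x := rfl
    have d1 := (dpow (-α - 1)).const_mul (-α)
    have d2 : Differentiable ℝ (fun y => -α * (V y + κ) ^ (-α - 1) * pd j V y) := d1.mul dVj
    rw [this, e1, hadd (fun y => pd j P y * (V y + κ) ^ (-α))
      (fun y => P y * (-α * (V y + κ) ^ (-α - 1) * pd j V y)) (dPj.mul (dpow _)) (dP.mul d2), aux_mul j (pd j P) _ x (dPj x) (dpow _ x),
      aux_mul j P _ x (dP x) (d2 x), aux_mul j _ (pd j V) x (d1 x) (dVj x),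
      aux_mul j (fun _ => -α) _ x (differentiableAt_const _) (dpow _ x), hpw, hpw]
    have h0 : pd j (fun _ : EuclideanSpace ℝ (Fin n) => -α) x = 0 := by simp [pd]
    have hp : pd2 j P x = pd j (pd j P) x := rfl
    have hv : pd2 j V x = pd j (pd j V) x := rfl
    rw [h0, hp, hv]; ring
  have e3 : P x / (V x + κ) ^ α = P x * (V x + κ) ^ (-α) := congrFun e0 x
  have h2 : ((V x + κ) ^ (2 * α))⁻¹ = ((V x + κ) ^ (-α)) ^ 2 := by
    rw [← Real.rpow_neg (hpos x).le, sq, ← Real.rpow_add (hpos x)]; ring_nf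
  rw [e3, e0, e2, e1]
  beta_reduce
  rw [h2, Real.rpow_sub_one (hpos x).ne' (-α - 1),
    Real.rpow_sub_one (hpos x).ne' (-α)]
  have := (hpos x).ne'
  field_simp
  ring

/-- lower bound on the divergence of the closed-loop density flux at a
point `x` of the sensing region (where `c_x ≤ ‖x‖ ≤ c̄_x`), in terms of the uniform
bounds on `Ψ` and `V` and their partial derivatives. -/
theorem stmt5 {n : ℕ} (hn : 1 ≤ n)
    (α β κ θ : ℝ) (hα : 0 < α) (hβ : 0 < β) (hκ : 0 < κ) (hθ : θ ∈ Set.Ioo (0:ℝ) 1)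
    (Ψ : ℝ → EuclideanSpace ℝ (Fin n) → ℝ)
    (hΨ : ∀ s, ContDiff ℝ 2 (Ψ s))
    (hΨb : ∀ s y, θ ≤ Ψ s y ∧ Ψ s y ≤ 1)
    (V : EuclideanSpace ℝ (Fin n) → ℝ)
    (hV : ContDiff ℝ 2 V) (hVnn : ∀ y, 0 ≤ V y)
    (ρo : ℝ → EuclideanSpace ℝ (Fin n) → ℝ)
    (hρo : ρo = fun s y => Ψ s y / (V y + κ) ^ α)
    (k : ℝ → EuclideanSpace ℝ (Fin n) → EuclideanSpace ℝ (Fin n))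
    (hk : k = fun s y => β • gradient (ρo s) y)
    -- the point (t,x) considered and the constants of the uniform bounds
    (t : ℝ) (x : EuclideanSpace ℝ (Fin n))
    (cΨx cΨx2 dV dVbar dVx dVxbar dVx2bar cx cxbar : ℝ)
    (hcΨx : 0 < cΨx) (hcΨx2 : 0 < cΨx2) (hdV : 0 < dV) (hdVbar : 0 < dVbar)
    (hdVx : 0 < dVx) (hdVxbar : 0 < dVxbar) (hdVx2bar : 0 < dVx2bar)
    (hcx : 0 < cx) (hcxbar : cx ≤ cxbar)
    (hΨx : ∀ j : Fin n, |pd j (Ψ t) x| ≤ cΨx)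
    (hΨx2 : ∀ j : Fin n, |pd2 j (Ψ t) x| ≤ cΨx2)
    (hVx2 : ∀ j : Fin n, pd2 j V x ≤ dVx2bar)
    (hVb : dV * ‖x‖ ^ 2 ≤ V x ∧ V x ≤ dVbar * ‖x‖ ^ 2)
    (hVx : ∀ j : Fin n, dVx * ‖x‖ ≤ |pd j V x| ∧ |pd j V x| ≤ dVxbar * ‖x‖)
    (hx : cx ≤ ‖x‖ ∧ ‖x‖ ≤ cxbar) :
    (α * β * n / (V x + κ) ^ (2 * α)) *
        ((2 * α + 1) * ((dVbar * cxbar ^ 2 + κ) ^ 2)⁻¹ * (dVx * cx * θ) ^ 2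
          - 4 * dV⁻¹ * dVxbar * cΨx * cx⁻¹
          - κ⁻¹ * dVx2bar
          - α⁻¹ * cΨx2)
      ≤ divergence (fun y => ρo t y • k t y) x := by
  have hpos : ∀ y, 0 < V y + κ := fun y => by linarith [hVnn y]
  have hρc : ContDiff ℝ 2 (fun y => Ψ t y / (V y + κ) ^ α) :=
    (hΨ t).div ((hV.add contDiff_const).rpow_const_of_ne fun y => (hpos y).ne')
      fun y => (Real.rpow_pos_of_pos (hpos y) _).ne'
  subst hk hρo
  have hD := aux_div _ hρc β x
  refine le_of_le_of_eq ?_ hD.symm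
  obtain ⟨hx1, hx2⟩ := hx
  obtain ⟨hV1, hV2⟩ := hVb
  obtain ⟨hP1, hP2⟩ := hΨb t x
  have hθ0 := hθ.1
  have hP0 : 0 < Ψ t x := hθ0.trans_le hP1
  have hx0 : 0 < ‖x‖ := hcx.trans_le hx1
  have hW := hpos x
  set A := ((V x + κ) ^ (2 * α))⁻¹ with hA
  have hA0 : 0 < A := inv_pos.2 (Real.rpow_pos_of_pos hW _)
  set B := ((2 * α + 1) * ((dVbar * cxbar ^ 2 + κ) ^ 2)⁻¹ * (dVx * cx * θ) ^ 2
          - 4 * dV⁻¹ * dVxbar * cΨx * cx⁻¹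
          - κ⁻¹ * dVx2bar
          - α⁻¹ * cΨx2) with hB
  have key : ∀ j ∈ Finset.univ, β * (A * (α * B)) ≤ β * (pd j (fun y => Ψ t y / (V y + κ) ^ α) x ^ 2
      + Ψ t x / (V x + κ) ^ α * pd2 j (fun y => Ψ t y / (V y + κ) ^ α) x) := by
    intro j _
    rw [aux_term j α κ hκ (Ψ t) V (hΨ t) hV hVnn x, ← hA]
    refine mul_le_mul_of_nonneg_left (mul_le_mul_of_nonneg_left ?_ hA0.le) hβ.le
    obtain ⟨hv1, hv2⟩ := hVx j
    have b1 : ((dVbar * cxbar ^ 2 + κ) ^ 2)⁻¹ * (dVx * cx * θ) ^ 2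
        ≤ (Ψ t x * pd j V x / (V x + κ)) ^ 2 := by
      rw [← sq_abs (Ψ t x * pd j V x / (V x + κ)), abs_div, abs_mul, abs_of_pos hP0, abs_of_pos hW,
        ← inv_pow, ← mul_pow, inv_mul_eq_div]
      have : dVx * cx ≤ |pd j V x| := (mul_le_mul_of_nonneg_left hx1 hdVx.le).trans hv1
      have h3 : V x + κ ≤ dVbar * cxbar ^ 2 + κ := by
        have : dVbar * ‖x‖ ^ 2 ≤ dVbar * cxbar ^ 2 := by gcongr
        linarith
      rw [mul_comm (dVx * cx)]
      gcongr
    have b2 : Ψ t x * pd j (Ψ t) x * (pd j V x / (V x + κ)) ≤ dV⁻¹ * dVxbar * cΨx * cx⁻¹ := by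
      refine (le_abs_self _).trans ?_
      rw [abs_mul, abs_mul, abs_div, abs_of_pos hP0, abs_of_pos hW]
      have h4 : |pd j V x| / (V x + κ) ≤ dV⁻¹ * dVxbar * cx⁻¹ := by
        calc |pd j V x| / (V x + κ) ≤ (dVxbar * ‖x‖) / (dV * ‖x‖ ^ 2) := by
              gcongr
              linarith
          _ = dV⁻¹ * dVxbar * ‖x‖⁻¹ := by field_simp
          _ ≤ _ := by gcongr
      calc Ψ t x * |pd j (Ψ t) x| * (|pd j V x| / (V x + κ))
          ≤ 1 * cΨx * (dV⁻¹ * dVxbar * cx⁻¹) := by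
            gcongr
            exact hΨx j
        _ = _ := by ring
    have b3 : Ψ t x ^ 2 * (pd2 j V x / (V x + κ)) ≤ κ⁻¹ * dVx2bar := by
      calc Ψ t x ^ 2 * (pd2 j V x / (V x + κ)) ≤ Ψ t x ^ 2 * (dVx2bar / (V x + κ)) := by
            gcongr
            exact hVx2 j
        _ ≤ 1 ^ 2 * (dVx2bar / κ) := by
            gcongr
            linarith [hVnn x]
        _ = _ := by ring
    have b4 : -cΨx2 ≤ Ψ t x * pd2 j (Ψ t) x := by
      have := (abs_le.1 (hΨx2 j)).1
      nlinarith
    have eB : α * B = α * (2 * α + 1) * (((dVbar * cxbar ^ 2 + κ) ^ 2)⁻¹ * (dVx * cx * θ) ^ 2)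
        - 4 * α * (dV⁻¹ * dVxbar * cΨx * cx⁻¹) - α * (κ⁻¹ * dVx2bar) - cΨx2 := by
      rw [hB]
      have : α * α⁻¹ = 1 := mul_inv_cancel₀ hα.ne'
      linear_combination (-cΨx2) * this
    rw [eB]
    have c1 := mul_le_mul_of_nonneg_left b1 (show 0 ≤ α * (2 * α + 1) by positivity)
    have c2 := mul_le_mul_of_nonneg_left b2 (show 0 ≤ 4 * α by positivity)
    have c3 := mul_le_mul_of_nonneg_left b3 hα.le
    have c0 := sq_nonneg (pd j (Ψ t) x)
    linarith
  have hs := Finset.sum_le_sum key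
  rw [Finset.sum_const, Finset.card_univ, Fintype.card_fin, nsmul_eq_mul] at hs
  refine le_of_eq_of_le ?_ hs
  rw [hA]; ring
end

section
/- Let α, β, κ > 0 and n ≥ 1. Every differentiable curve e : [0,∞) → ℝⁿ satisfying ė(t) = −( 2αβ / ( ‖e(t)‖² + κ )^{α+1} ) e(t) for all t ≥ 0 obeys the exponential bound ‖e(t)‖ ≤ ‖e(0)‖ e^{−K t} for all t ≥ 0, where K = 2αβ ( ‖e(0)‖² + κ )^{−(α+1)} > 0; in particular e(t) → 0 as t → ∞. -/
open Set Filter Metric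
open scoped Topology

/-- exponential decay of the tracking error: every differentiable
curve `e : [0,∞) → ℝⁿ` satisfying `ė = −(2αβ/(‖e‖² + κ)^{α+1}) e` obeys
`‖e(t)‖ ≤ ‖e(0)‖ e^{−Kt}` with `K = 2αβ(‖e(0)‖² + κ)^{−(α+1)} > 0`; in particular
`e(t) → 0` as `t → ∞`. -/
theorem stmt14 {n : ℕ} (hn : 1 ≤ n)
    (α β κ : ℝ) (hα : 0 < α) (hβ : 0 < β) (hκ : 0 < κ)
    (e : ℝ → EuclideanSpace ℝ (Fin n))
    (he : ∀ t ∈ Set.Ici (0:ℝ),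
      HasDerivWithinAt e
        ((-(2 * α * β / (‖e t‖ ^ 2 + κ) ^ (α + 1))) • e t) (Set.Ici (0:ℝ)) t) :
    0 < 2 * α * β * (‖e 0‖ ^ 2 + κ) ^ (-(α + 1))
    ∧ (∀ t : ℝ, 0 ≤ t →
        ‖e t‖ ≤ ‖e 0‖ * Real.exp (-(2 * α * β * (‖e 0‖ ^ 2 + κ) ^ (-(α + 1))) * t))
    ∧ Tendsto e atTop (𝓝 0) := by
  have hpos : ∀ t, 0 < ‖e t‖ ^ 2 + κ := fun t => by positivity
  have hKpos : 0 < 2 * α * β * (‖e 0‖ ^ 2 + κ) ^ (-(α + 1)) :=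
    mul_pos (by positivity) (Real.rpow_pos_of_pos (hpos 0) _)
  have hd : ∀ t ∈ Set.Ici (0:ℝ), HasDerivWithinAt (fun t => ‖e t‖ ^ 2)
      (-(2 * (2 * α * β / (‖e t‖ ^ 2 + κ) ^ (α + 1)) * ‖e t‖ ^ 2)) (Set.Ici (0:ℝ)) t := by
    intro t ht
    have h := (he t ht).norm_sq
    rw [real_inner_smul_right, real_inner_self_eq_norm_sq] at h
    convert h using 1
    ring
  have hanti : AntitoneOn (fun t => ‖e t‖ ^ 2) (Set.Ici (0:ℝ)) := by
    refine antitoneOn_of_hasDerivWithinAt_nonpos (convex_Ici 0)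
      (fun t ht => (hd t ht).continuousWithinAt)
      (fun t ht => (hd t (interior_subset ht)).mono interior_subset) ?_
    intro t _
    have := Real.rpow_pos_of_pos (hpos t) (α + 1)
    have : 0 ≤ 2 * (2 * α * β / (‖e t‖ ^ 2 + κ) ^ (α + 1)) * ‖e t‖ ^ 2 := by positivity
    linarith
  have hgain : ∀ t ∈ Set.Ici (0:ℝ), 2 * α * β * (‖e 0‖ ^ 2 + κ) ^ (-(α + 1))
      ≤ 2 * α * β / (‖e t‖ ^ 2 + κ) ^ (α + 1) := by
    intro t ht
    have h1 : ‖e t‖ ^ 2 ≤ ‖e 0‖ ^ 2 := hanti Set.self_mem_Ici ht ht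
    have h3 := Real.rpow_pos_of_pos (hpos t) (α + 1)
    have h2 : (‖e t‖ ^ 2 + κ) ^ (α + 1) ≤ (‖e 0‖ ^ 2 + κ) ^ (α + 1) :=
      Real.rpow_le_rpow (hpos t).le (by linarith) (by linarith)
    rw [Real.rpow_neg (hpos 0).le, ← div_eq_mul_inv]
    exact div_le_div_of_nonneg_left (by positivity) h3 h2
  generalize 2 * α * β * (‖e 0‖ ^ 2 + κ) ^ (-(α + 1)) = K at *
  have hd2 : ∀ t ∈ Set.Ici (0:ℝ), HasDerivWithinAt (fun t => ‖e t‖ ^ 2 * Real.exp (2 * K * t))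
      (-(2 * (2 * α * β / (‖e t‖ ^ 2 + κ) ^ (α + 1)) * ‖e t‖ ^ 2) * Real.exp (2 * K * t)
        + ‖e t‖ ^ 2 * (Real.exp (2 * K * t) * (2 * K * 1))) (Set.Ici (0:ℝ)) t := by
    intro t ht
    exact (hd t ht).mul (((hasDerivAt_id t).const_mul (2 * K)).exp.hasDerivWithinAt)
  have hanti2 : AntitoneOn (fun t => ‖e t‖ ^ 2 * Real.exp (2 * K * t)) (Set.Ici (0:ℝ)) := by
    refine antitoneOn_of_hasDerivWithinAt_nonpos (convex_Ici 0)
      (fun t ht => (hd2 t ht).continuousWithinAt)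
      (fun t ht => (hd2 t (interior_subset ht)).mono interior_subset) ?_
    intro t ht
    have h := hgain t (interior_subset ht)
    have h0 : 0 ≤ ‖e t‖ ^ 2 * Real.exp (2 * K * t) := by positivity
    have := mul_nonneg h0 (sub_nonneg.2 h)
    linarith
  have hbound : ∀ t : ℝ, 0 ≤ t → ‖e t‖ ≤ ‖e 0‖ * Real.exp (-K * t) := by
    intro t ht
    have h : ‖e t‖ ^ 2 * Real.exp (2 * K * t) ≤ ‖e 0‖ ^ 2 * Real.exp (2 * K * 0) :=
      hanti2 Set.self_mem_Ici ht ht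
    have h1 : Real.exp (2 * K * t) = Real.exp (K * t) ^ 2 := by
      rw [← Real.exp_nat_mul]; congr 1; push_cast; ring
    rw [h1, mul_zero, Real.exp_zero, mul_one, ← mul_pow] at h
    have h2 := (pow_le_pow_iff_left₀ (by positivity) (norm_nonneg _) two_ne_zero).1 h
    rw [neg_mul, Real.exp_neg, ← div_eq_mul_inv, le_div_iff₀ (Real.exp_pos _)]
    exact h2
  refine ⟨hKpos, hbound, ?_⟩
  rw [tendsto_zero_iff_norm_tendsto_zero]
  have hlim : Tendsto (fun t : ℝ => ‖e 0‖ * Real.exp (-K * t)) atTop (𝓝 0) := by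
    have h1 : Tendsto (fun t : ℝ => -K * t) atTop atBot :=
      tendsto_id.const_mul_atTop_of_neg (neg_lt_zero.2 hKpos)
    simpa using (Real.tendsto_exp_atBot.comp h1).const_mul ‖e 0‖
  refine tendsto_of_tendsto_of_tendsto_of_le_of_le' tendsto_const_nhds hlim
    (Eventually.of_forall fun t => norm_nonneg _) ?_
  filter_upwards [eventually_ge_atTop 0] with t ht using hbound t ht
end
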